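/- arXiv:2510.10818 — 7 statements merged into one kernel-verified Lean document; each statement's English description precedes it below -/
import Mathlib

section
/- If a mutex state (Q, o) satisfies the invariant INV, p ∉ Q, and o ≠ some p, then the state (Q ++ [p], o) obtained by performing the enqueue p step also satisfies INV; moreover the length of the queue increases by exactly one and the head of the queue is unchanged whenever Q is nonempty. -/
/-- Labels of the atomic steps of the claim/release transition system. -/
inductive Label (P : Type*) where
  | enqueue (p : P)
  | claimCAS (p : P)
  | stealCAS (p : P)
  | dequeue (p : P)
  | releaseSet (p : P)

/-- A mutex state: wait queue (head at front) together with the current owner. -/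
abbrev MState (P : Type*) := List P × Option P

/-- The labelled transition steps of the claim/release protocol. -/
inductive Step {P : Type*} [DecidableEq P] : Label P → MState P → MState P → Prop where
  | enqueue {p : P} {Q : List P} {o : Option P} (hmem : p ∉ Q) (ho : o ≠ some p) :
      Step (.enqueue p) (Q, o) (Q ++ [p], o)
  | claimCAS {p : P} {Q : List P} (hhead : Q.head? = some p) :
      Step (.claimCAS p) (Q, none) (Q, some p)
  | stealCAS {p q : P} {Q : List P} (hhead : Q.head? = some p) (hq : q ∉ Q) :
      Step (.stealCAS p) (Q, some q) (Q, some p)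
  | dequeue {p : P} {Q : List P} (hhead : Q.head? = some p) :
      Step (.dequeue p) (Q, some p) (Q.tail, some p)
  | releaseSet {p : P} {Q : List P} (hp : p ∉ Q) :
      Step (.releaseSet p) (Q, some p) (Q, Q.head?)

/-- Unlocked: no owner and empty queue. -/
def Unlocked {P : Type*} (s : MState P) : Prop := s.2 = none ∧ s.1 = []

/-- Claiming: no owner but nonempty queue. -/
def Claiming {P : Type*} (s : MState P) : Prop := s.2 = none ∧ s.1 ≠ []

/-- Locked: the owner is the head of the nonempty queue. -/
def Locked {P : Type*} (s : MState P) : Prop := s.2 = s.1.head? ∧ s.1 ≠ []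

/-- Releasing: there is an owner, and the owner is not in the queue. -/
def Releasing {P : Type*} (s : MState P) : Prop := ∃ q, s.2 = some q ∧ q ∉ s.1

/-- The mutex invariant: the queue has no duplicates, and one of the four
ownership cases holds. -/
def INV {P : Type*} (s : MState P) : Prop :=
  s.1.Nodup ∧ (Unlocked s ∨ Claiming s ∨ Locked s ∨ Releasing s)

/-- Reachability from the initial state `([], none)` by finitely many steps. -/
inductive Reachable {P : Type*} [DecidableEq P] : MState P → Prop where
  | init : Reachable ([], none)
  | step {s t : MState P} {l : Label P} : Reachable s → Step l s t → Reachable t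

theorem enqueue_preserves_INV {P : Type*} [DecidableEq P] (Q : List P) (o : Option P) (p : P)
    (hINV : INV (Q, o)) (hmem : p ∉ Q) (ho : o ≠ some p) :
    INV (Q ++ [p], o) ∧ (Q ++ [p]).length = Q.length + 1 ∧
      (Q ≠ [] → (Q ++ [p]).head? = Q.head?) := by
  obtain ⟨hnodup, hown⟩ := hINV
  have head_eq : Q ≠ [] → (Q ++ [p]).head? = Q.head? := fun hQ =>
    List.head?_append_of_ne_nil Q hQ
  have append_ne : Q ++ [p] ≠ [] := by simp
  refine ⟨⟨List.concat_eq_append ▸ hnodup.concat hmem, ?_⟩, by simp, head_eq⟩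
  rcases hown with ⟨hnone, -⟩ | ⟨hnone, -⟩ | ⟨hhead, hQ⟩ | ⟨q, hq, hqQ⟩
  · exact .inr (.inl ⟨hnone, append_ne⟩)
  · exact .inr (.inl ⟨hnone, append_ne⟩)
  · exact .inr (.inr (.inl ⟨hhead.trans (head_eq hQ).symm, append_ne⟩))
  · refine .inr (.inr (.inr ⟨q, hq, ?_⟩))
    have hqp : q ≠ p := fun h => ho (h ▸ hq)
    simpa [hqp] using hqQ
end

section
/- Every reachable mutex state satisfies the invariant INV. In particular, exclusive ownership holds in every reachable state (Q, o): if o = some p, then either Q.head? = some p or p ∉ Q. -/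
/-- The invariant says that the queue has no duplicates and that an owner is either at the head of
the queue or not queued at all. -/
theorem INV_iff {P : Type*} {s : MState P} :
    INV s ↔ s.1.Nodup ∧ ∀ p : P, s.2 = some p → s.1.head? = some p ∨ p ∉ s.1 := by
  obtain ⟨Q, o⟩ := s
  cases Q <;> cases o <;> simp [INV, Unlocked, Claiming, Locked, Releasing, eq_comm]

theorem Step.inv {P : Type*} [DecidableEq P] {l : Label P} {s t : MState P}
    (h : Step l s t) (hs : INV s) : INV t := by
  rw [INV_iff] at hs ⊢
  obtain ⟨hnodup, howner⟩ := hs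
  cases h with
  | @enqueue p Q o hmem ho =>
    refine ⟨List.nodup_append_comm.mp (by simpa using ⟨hmem, hnodup⟩), fun r hr => ?_⟩
    have hne : r ≠ p := fun e => ho (e ▸ hr)
    rcases howner r hr with hhead | hr'
    · left
      simp_all [List.head?_append]
    · right
      simp_all
  | claimCAS hhead => exact ⟨hnodup, fun r hr => .inl (hhead.trans hr)⟩
  | stealCAS hhead hq => exact ⟨hnodup, fun r hr => .inl (hhead.trans hr)⟩
  | @dequeue p Q hhead =>
    refine ⟨hnodup.tail, fun r hr => .inr ?_⟩
    cases Q <;> simp_all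
  | releaseSet hp => exact ⟨hnodup, fun r hr => .inl hr⟩

theorem Reachable.inv {P : Type*} [DecidableEq P] {s : MState P} (h : Reachable s) : INV s := by
  induction h with
  | init => exact ⟨List.nodup_nil, .inl ⟨rfl, rfl⟩⟩
  | step _ hstep ih => exact hstep.inv ih

theorem reachable_satisfies_INV {P : Type*} [DecidableEq P] :
    ∀ s : MState P, Reachable s →
      INV s ∧ ∀ p : P, s.2 = some p → s.1.head? = some p ∨ p ∉ s.1 := by
  exact fun s h => ⟨h.inv, (INV_iff.mp h.inv).2⟩
end

section
/- Single-step stability of the lock: let (Q, some p) be a Locked mutex state, i.e., Q.head? = some p. Then every transition step enabled at this state is either an enqueue step by some process or the dequeue p step; in particular, no single transition step from a Locked state changes the owner component, and no claimCAS, stealCAS, or releaseSet step is enabled. -/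
theorem single_step_stability {P : Type*} [DecidableEq P] (Q : List P) (p : P)
    (hhead : Q.head? = some p) :
    (∀ (l : Label P) (t : MState P), Step l (Q, some p) t →
        ((∃ r, l = Label.enqueue r) ∨ l = Label.dequeue p) ∧ t.2 = some p)
    ∧ (∀ (r : P) (t : MState P), ¬ Step (Label.claimCAS r) (Q, some p) t)
    ∧ (∀ (r : P) (t : MState P), ¬ Step (Label.stealCAS r) (Q, some p) t)
    ∧ (∀ (r : P) (t : MState P), ¬ Step (Label.releaseSet r) (Q, some p) t) := by
  have hmem : p ∈ Q := List.mem_of_head? hhead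
  refine ⟨fun l t h => ?_, fun r t h => ?_, fun r t h => ?_, fun r t h => ?_⟩
  · cases h with
    | enqueue _ _ => exact ⟨Or.inl ⟨_, rfl⟩, rfl⟩
    | stealCAS _ hq => exact absurd hmem hq
    | dequeue _ => exact ⟨Or.inr rfl, rfl⟩
    | releaseSet hp => exact absurd hmem hp
  · cases h
  · cases h with
    | stealCAS _ hq => exact hq hmem
  · cases h with
    | releaseSet hp => exact hp hmem
end

section
/- Multi-step stability of the lock (mutual exclusion): let s₀ = (Q₀, some p) be a Locked state with Q₀.head? = some p, and let s₀, s₁, …, s_k be an execution fragment (each s_{i+1} obtained from s_i by one transition step) in which no step is the dequeue p step. Then every state s_i is Locked with owner some p and queue head some p; i.e., once process p holds the lock, the mutex remains locked by p until p performs its dequeue step. -/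
theorem Step.owner_head_stable {P : Type*} [DecidableEq P] {l : Label P} {s t : MState P} {p : P}
    (h : Step l s t) (hl : l ≠ Label.dequeue p) (howner : s.2 = some p)
    (hhead : s.1.head? = some p) : t.2 = some p ∧ t.1.head? = some p := by
  have hmem : p ∈ s.1 := List.mem_of_head? hhead
  cases h <;> simp_all

theorem multi_step_stability {P : Type*} [DecidableEq P] (k : ℕ)
    (s : ℕ → MState P) (l : ℕ → Label P) (p : P) (Q₀ : List P)
    (hinit : s 0 = (Q₀, some p)) (hhead : Q₀.head? = some p)
    (hstep : ∀ i < k, Step (l i) (s i) (s (i + 1)))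
    (hnodeq : ∀ i < k, l i ≠ Label.dequeue p) :
    ∀ i ≤ k, (s i).2 = some p ∧ (s i).1.head? = some p ∧ Locked (s i) := by
  have hlocked : ∀ i ≤ k, (s i).2 = some p ∧ (s i).1.head? = some p := by
    intro i
    induction i with
    | zero => simp [hinit, hhead]
    | succ n ih =>
      intro hn
      obtain ⟨howner, hfront⟩ := ih (by omega)
      exact (hstep n hn).owner_head_stable (hnodeq n hn) howner hfront
  intro i hi
  obtain ⟨howner, hfront⟩ := hlocked i hi
  exact ⟨howner, hfront, howner.trans hfront.symm, List.ne_nil_of_mem (List.mem_of_head? hfront)⟩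
end

section
/- FIFO fairness of acquisition: in any execution from the initial state, suppose the step at index i has label enqueue p and the step at index j has label enqueue q with i < j and p ≠ q. If i' is the least index greater than i at which p acquires ownership and j' is the least index greater than j at which q acquires ownership, and both exist, then i' < j'; that is, processes acquire the lock in the order of their enqueue steps. -/
/-- Some occurrence of `p` in `Q` is preceded by no occurrence of `r`. -/
def Ahead {P : Type*} (p r : P) (Q : List P) : Prop := ∃ a b, Q = a ++ p :: b ∧ r ∉ a

theorem Ahead.mem {P : Type*} {p r : P} {Q : List P} (h : Ahead p r Q) : p ∈ Q := by
  obtain ⟨a, b, rfl, -⟩ := h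
  simp

theorem Ahead.head?_ne {P : Type*} {p r : P} {Q : List P} (h : Ahead p r Q) (hpr : p ≠ r) :
    Q.head? ≠ some r := by
  obtain ⟨a, b, rfl, ha⟩ := h
  cases a with
  | nil => simpa using hpr
  | cons x a => simpa using fun hx : x = r => ha (by simp [hx])

theorem Ahead.append {P : Type*} {p r : P} {Q : List P} (h : Ahead p r Q) (Q' : List P) :
    Ahead p r (Q ++ Q') := by
  obtain ⟨a, b, rfl, ha⟩ := h
  exact ⟨a, b ++ Q', by simp, ha⟩

theorem Ahead.tail {P : Type*} {p r : P} {Q : List P} (h : Ahead p r Q)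
    (hp : Q.head? ≠ some p) : Ahead p r Q.tail := by
  obtain ⟨a, b, rfl, ha⟩ := h
  cases a with
  | nil => simp at hp
  | cons x a => exact ⟨a, b, rfl, fun hr => ha (List.mem_cons_of_mem x hr)⟩

theorem ahead_of_mem_of_notMem {P : Type*} {p r : P} {Q : List P} (hp : p ∈ Q) (hr : r ∉ Q) :
    Ahead p r Q := by
  obtain ⟨a, b, rfl⟩ := List.append_of_mem hp
  exact ⟨a, b, rfl, fun h => hr (List.mem_append_left _ h)⟩

/-- A process that does not own the lock keeps its place in the queue. -/
theorem Step.ahead {P : Type*} [DecidableEq P] {l : Label P} {s t : MState P} (h : Step l s t)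
    {p r : P} (hp : s.2 ≠ some p) (ha : Ahead p r s.1) : Ahead p r t.1 := by
  cases h with
  | enqueue => exact ha.append _
  | dequeue hhead => exact ha.tail (hhead ▸ hp)
  | claimCAS | stealCAS | releaseSet => exact ha

/-- Ownership is acquired only from the head of the queue. -/
theorem Step.head?_of_acquire {P : Type*} [DecidableEq P] {l : Label P} {s t : MState P}
    (h : Step l s t) {p : P} (hs : s.2 ≠ some p) (ht : t.2 = some p) :
    s.1.head? = some p := by
  cases h with
  | enqueue | dequeue => exact absurd ht hs
  | claimCAS hhead | stealCAS hhead => exact hhead.trans ht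
  | releaseSet => exact ht

theorem Step.of_enqueue {P : Type*} [DecidableEq P] {p : P} {s t : MState P}
    (h : Step (.enqueue p) s t) :
    p ∉ s.1 ∧ s.2 ≠ some p ∧ t = (s.1 ++ [p], s.2) := by
  cases h with
  | enqueue hmem ho => exact ⟨hmem, ho, rfl⟩

/-- The place of a process in the queue persists along steps during which it is not the owner. -/
theorem ahead_of_le {P : Type*} [DecidableEq P] {s : ℕ → MState P} {l : ℕ → Label P}
    {p r : P} {m n : ℕ} (hmn : m ≤ n)
    (hstep : ∀ i, m ≤ i → i < n → Step (l i) (s i) (s (i + 1)))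
    (hown : ∀ i, m ≤ i → i < n → (s i).2 ≠ some p) (ha : Ahead p r (s m).1) :
    Ahead p r (s n).1 := by
  induction n, hmn using Nat.le_induction with
  | base => exact ha
  | succ n hmn ih =>
    exact (hstep n hmn n.lt_succ_self).ahead (hown n hmn n.lt_succ_self)
      (ih (fun i h h' => hstep i h (h'.trans n.lt_succ_self))
        fun i h h' => hown i h (h'.trans n.lt_succ_self))

theorem fifo_fairness {P : Type*} [DecidableEq P] (k : ℕ)
    (s : ℕ → MState P) (l : ℕ → Label P)
    (hinit : s 0 = (([] : List P), none))
    (hstep : ∀ i < k, Step (l i) (s i) (s (i + 1)))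
    (p q : P) (hpq : p ≠ q) (i j : ℕ) (hik : i < k) (hjk : j < k) (hij : i < j)
    (hlp : l i = Label.enqueue p) (hlq : l j = Label.enqueue q)
    (i' j' : ℕ) (hi'k : i' < k) (hj'k : j' < k) (hii' : i < i') (hjj' : j < j')
    (hacqp : (s i').2 ≠ some p ∧ (s (i' + 1)).2 = some p)
    (hacqq : (s j').2 ≠ some q ∧ (s (j' + 1)).2 = some q)
    (hminp : ∀ m, i < m → m < k → ((s m).2 ≠ some p ∧ (s (m + 1)).2 = some p) → i' ≤ m)
    (hminq : ∀ m, j < m → m < k → ((s m).2 ≠ some q ∧ (s (m + 1)).2 = some q) → j' ≤ m) :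
    i' < j' := by
  by_contra! hle
  obtain ⟨hpQ, hpo, hsi⟩ := Step.of_enqueue (hlp ▸ hstep i hik)
  obtain ⟨hqQ, -, -⟩ := Step.of_enqueue (hlq ▸ hstep j hjk)
  have hown : ∀ m, i + 1 ≤ m → m ≤ i' → (s m).2 ≠ some p := by
    intro m hm
    induction m, hm using Nat.le_induction with
    | base => intro _; rwa [hsi]
    | succ m hm ih =>
      intro hmi h
      have := hminp m hm (by omega) ⟨ih (by omega), h⟩
      omega
  have hmem : p ∈ (s j).1 := by
    refine (ahead_of_le (r := p) (m := i + 1) (by omega) (fun m _ _ => hstep m (by omega))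
      (fun m h _ => hown m h (by omega)) ?_).mem
    rw [hsi]
    exact ⟨_, [], rfl, hpQ⟩
  have hahead : Ahead p q (s j').1 :=
    ahead_of_le (by omega) (fun m _ _ => hstep m (by omega))
      (fun m _ _ => hown m (by omega) (by omega)) (ahead_of_mem_of_notMem hmem hqQ)
  exact hahead.head?_ne hpq ((hstep j' hj'k).head?_of_acquire hacqq.1 hacqq.2)
end

section
/- No double acquisition without release: in any execution from the initial state, if process p acquires ownership at step index i and again at step index j with i < j, then there exists an index k with i < k < j at which the dequeue p step occurs. -/
/-- A step that makes `p` the owner finds `p` at the head of the queue and leaves it there. -/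
theorem Step.head?_eq_of_acquires {P : Type*} [DecidableEq P] {l : Label P} {s t : MState P}
    {p : P} (h : Step l s t) (hs : s.2 ≠ some p) (ht : t.2 = some p) :
    t.1.head? = some p := by
  cases h <;> simp_all

/-- Only `dequeue p` can end a situation in which `p` is both the owner and the queue head. -/
theorem Step.owner_and_head_preserved {P : Type*} [DecidableEq P] {l : Label P} {s t : MState P}
    {p : P} (h : Step l s t) (hl : l ≠ Label.dequeue p)
    (hs : s.2 = some p ∧ s.1.head? = some p) :
    t.2 = some p ∧ t.1.head? = some p := by
  cases h <;> simp_all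

theorem no_double_acquisition_without_release {P : Type*} [DecidableEq P] (k : ℕ)
    (s : ℕ → MState P) (l : ℕ → Label P)
    (hinit : s 0 = (([] : List P), none))
    (hstep : ∀ i < k, Step (l i) (s i) (s (i + 1)))
    (p : P) (i j : ℕ) (hik : i < k) (hjk : j < k) (hij : i < j)
    (hacqi : (s i).2 ≠ some p ∧ (s (i + 1)).2 = some p)
    (hacqj : (s j).2 ≠ some p ∧ (s (j + 1)).2 = some p) :
    ∃ m, i < m ∧ m < j ∧ l m = Label.dequeue p := by
  by_contra! hno
  have key : ∀ n, i + 1 ≤ n → n ≤ j → (s n).2 = some p ∧ (s n).1.head? = some p := by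
    intro n hn
    induction n, hn using Nat.le_induction with
    | base =>
      exact fun _ => ⟨hacqi.2, (hstep i hik).head?_eq_of_acquires hacqi.1 hacqi.2⟩
    | succ n hn ih =>
      exact fun hnj => (hstep n (by omega)).owner_and_head_preserved
        (hno n (by omega) (by omega)) (ih (by omega))
  exact hacqj.1 (key j hij le_rfl).1
end

section
/- FIFO queue discipline: in any execution from the initial state ending in a state (Q, o), the list of process labels of the enqueue steps, taken in order of occurrence, equals the list of process labels of the dequeue steps taken in order of occurrence, followed by Q. In particular, the sequence of dequeued processes is a prefix of the sequence of enqueued processes, so the order in which processes leave the wait queue equals the order in which they entered it. -/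
/-- The process enqueued by a label, if it is an enqueue label. -/
def enq? {P : Type*} : Label P → Option P
  | .enqueue p => some p
  | _ => none

/-- The process dequeued by a label, if it is a dequeue label. -/
def deq? {P : Type*} : Label P → Option P
  | .dequeue p => some p
  | _ => none

/-- An execution fragment from a state to a state along a list of labels. -/
inductive Exec {P : Type*} [DecidableEq P] : MState P → List (Label P) → MState P → Prop where
  | nil (s : MState P) : Exec s [] s
  | cons {s t u : MState P} {l : Label P} {L : List (Label P)} :
      Step l s t → Exec t L u → Exec s (l :: L) u

/-- Along any execution fragment, the initial queue followed by the enqueued processes equals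
the dequeued processes followed by the final queue. -/
theorem Exec.queue_append_enq_eq {P : Type*} [DecidableEq P] {s t : MState P}
    {L : List (Label P)} (h : Exec s L t) :
    s.1 ++ L.filterMap enq? = L.filterMap deq? ++ t.1 := by
  induction h with
  | nil s => simp
  | cons hstep _ ih =>
    cases hstep with
    | enqueue => simpa [List.filterMap_cons, enq?, deq?] using ih
    | claimCAS => simpa [List.filterMap_cons, enq?, deq?] using ih
    | stealCAS => simpa [List.filterMap_cons, enq?, deq?] using ih
    | releaseSet => simpa [List.filterMap_cons, enq?, deq?] using ih
    | dequeue hhead =>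
      obtain ⟨Q', rfl⟩ := List.head?_eq_some_iff.mp hhead
      simpa [List.filterMap_cons, enq?, deq?] using ih

theorem fifo_queue_discipline {P : Type*} [DecidableEq P]
    (L : List (Label P)) (Q : List P) (o : Option P)
    (h : Exec ([], none) L (Q, o)) :
    L.filterMap enq? = L.filterMap deq? ++ Q
    ∧ (L.filterMap deq?) <+: (L.filterMap enq?) := by
  have heq : L.filterMap enq? = L.filterMap deq? ++ Q := by
    simpa using h.queue_append_enq_eq
  exact ⟨heq, Q, heq.symm⟩
end
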